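/- For all 0 < k ≤ ℓ < n, the polynomial O(n,k)·O(n,ℓ) − O(n−1, k−1)·O(n+1, ℓ+1) has non-negative coefficients as a polynomial in q and t, where O(a,b) is the over-(q,t)-binomial coefficient for the (a−b)×b rectangle. -/

import Mathlib

open Finset Polynomial

/-- `overp m n k N` is the number of overpartitions of `N` with `k` overlined parts,
largest part `≤ m`, and at most `n` parts. An overpartition is a partition together
with a subset of its (distinct) part sizes which are overlined. -/
noncomputable def overp (m n k N : ℕ) : ℕ :=
  Nat.card {p : Nat.Partition N × Finset ℕ //
    (∀ i ∈ p.1.parts, i ≤ m) ∧ Multiset.card p.1.parts ≤ n ∧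
    p.2 ⊆ p.1.parts.toFinset ∧ p.2.card = k}

/-- The over-(q,t)-binomial coefficient for the `m × n` rectangle, evaluated at
elements `q t` of a commutative ring. -/
noncomputable def Oqt {R : Type*} [CommRing R] (q t : R) (m n : ℕ) : R :=
  ∑ N ∈ range (m * n + 1), ∑ k ∈ range (n + 1), (overp m n k N : R) * t ^ k * q ^ N

/-- The over-(q,t)-binomial coefficient for overpartitions fitting inside an
(a-b) x b rectangle, as a polynomial in q (outer variable) and t (inner variable). -/
noncomputable def OqtP (a b : ℕ) : Polynomial (Polynomial ℤ) :=
  ∑ N ∈ range ((a - b) * b + 1), ∑ k ∈ range (b + 1),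
    Polynomial.C (Polynomial.C (overp (a - b) b k N : ℤ) * Polynomial.X ^ k) * Polynomial.X ^ N

/-- Coefficientwise non-negative bivariate integer polynomials. -/
def NNP (p : Polynomial (Polynomial ℤ)) : Prop := ∀ N K : ℕ, 0 ≤ (p.coeff N).coeff K

lemma NNP.zero : NNP 0 := by intro N K; simp

lemma NNP.add {p r : Polynomial (Polynomial ℤ)} (hp : NNP p) (hr : NNP r) : NNP (p + r) := by
  intro N K
  simpa using add_nonneg (hp N K) (hr N K)

lemma NNP.sum {ι : Type*} {s : Finset ι} {f : ι → Polynomial (Polynomial ℤ)}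
    (h : ∀ i ∈ s, NNP (f i)) : NNP (∑ i ∈ s, f i) := by
  intro N K
  simp only [Polynomial.finsetSum_coeff]
  exact Finset.sum_nonneg fun i hi => h i hi N K

lemma NNP.mul {p r : Polynomial (Polynomial ℤ)} (hp : NNP p) (hr : NNP r) : NNP (p * r) := by
  intro N K
  simp only [Polynomial.coeff_mul, Polynomial.finsetSum_coeff]
  exact Finset.sum_nonneg fun i _ => Finset.sum_nonneg fun j _ => mul_nonneg (hp _ _) (hr _ _)

/-- The two-row flagged Jacobi-Trudi determinant. -/
noncomputable def DD (G : ℕ → ℕ → Polynomial (Polynomial ℤ)) (a k b l : ℕ) : Polynomial (Polynomial ℤ) :=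
  G a (k + 1) * G b (l + 1) - G a k * G b (l + 2)

lemma DD_nonneg (G : ℕ → ℕ → Polynomial (Polynomial ℤ)) (x y : ℕ → Polynomial (Polynomial ℤ))
    (hx : ∀ a, NNP (x a)) (hy : ∀ a, NNP (y a)) (hG : ∀ a k, NNP (G a k))
    (h0 : ∀ a, G a 0 = 0) (h1 : ∀ k, G 0 (k + 1) = 1)
    (hrec : ∀ a k, G (a + 1) (k + 1) = G a (k + 1) + x a * G (a + 1) k + y a * G a k) :
    ∀ s a k b l, a + k + b + l = s → b ≤ a → k ≤ l → NNP (DD G a k b l) := by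
  intro s
  induction s using Nat.strong_induction_on with
  | _ s ih =>
  intro a k b l hs hba hkl
  rcases k with _ | k
  · have : DD G a 0 b l = G a 1 * G b (l + 1) := by simp [DD, h0]
    rw [this]
    exact (hG _ _).mul (hG _ _)
  obtain ⟨l, rfl⟩ : ∃ l', l = l' + 1 := ⟨l - 1, by omega⟩
  rcases hba.lt_or_eq with hlt | rfl
  · obtain ⟨a, rfl⟩ : ∃ a', a = a' + 1 := ⟨a - 1, by omega⟩
    have : DD G (a + 1) (k + 1) b (l + 1) = DD G a (k + 1) b (l + 1)
        + x a * DD G (a + 1) k b (l + 1) + y a * DD G a k b (l + 1) := by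
      simp only [DD]
      rw [hrec a (k + 1), hrec a k]
      ring
    rw [this]
    refine ((ih _ ?_ a (k + 1) b (l + 1) rfl (by omega) (by omega)).add
      ((hx a).mul (ih _ ?_ (a + 1) k b (l + 1) rfl (by omega) (by omega)))).add
      ((hy a).mul (ih _ ?_ a k b (l + 1) rfl (by omega) (by omega))) <;> omega
  · rcases b with _ | b
    · have : DD G 0 (k + 1) 0 (l + 1) = 0 := by simp [DD, h1]
      rw [this]
      exact NNP.zero
    have e : DD G (b + 1) (k + 1) (b + 1) (l + 1) = DD G (b + 1) (k + 1) b (l + 1)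
        + x b * DD G (b + 1) (k + 1) (b + 1) l + y b * DD G (b + 1) (k + 1) b l := by
      simp only [DD]
      linear_combination G (b + 1) (k + 1 + 1) * hrec b (l + 1) - G (b + 1) (k + 1) * hrec b (l + 2)
    rw [e]
    have n1 : NNP (DD G (b + 1) (k + 1) b (l + 1)) :=
      ih _ (by omega) (b + 1) (k + 1) b (l + 1) rfl (by omega) (by omega)
    rcases (show k ≤ l by omega).lt_or_eq with hlt | rfl
    · exact (n1.add ((hx b).mul (ih _ (by omega) (b + 1) (k + 1) (b + 1) l rfl
        (by omega) (by omega)))).add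
        ((hy b).mul (ih _ (by omega) (b + 1) (k + 1) b l rfl (by omega) (by omega)))
    · have z : DD G (b + 1) (k + 1) (b + 1) k = 0 := by simp only [DD]; ring
      have e2 : DD G (b + 1) (k + 1) b k
          = x b * DD G (b + 1) k b k + y b * DD G b k b k := by
        simp only [DD]
        rw [hrec b (k + 1), hrec b k]
        ring
      rw [z, mul_zero, add_zero, e2]
      exact n1.add ((hy b).mul
        (((hx b).mul (ih _ (by omega) (b + 1) k b k rfl (by omega) (by omega))).add
        ((hy b).mul (ih _ (by omega) b k b k rfl (by omega) (by omega)))))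

/-- The finite set of overpartitions in an `m × n` box. -/
def AA (m n : ℕ) : Finset (Multiset ℕ × Finset ℕ) :=
  ((n • (Icc 1 m).val).powerset.toFinset ×ˢ (Icc 1 m).powerset).filter fun p =>
    (∀ i ∈ p.1, 1 ≤ i ∧ i ≤ m) ∧ Multiset.card p.1 ≤ n ∧ p.2 ⊆ p.1.toFinset

lemma mem_AA {m n : ℕ} {p : Multiset ℕ × Finset ℕ} : p ∈ AA m n ↔
    (∀ i ∈ p.1, 1 ≤ i ∧ i ≤ m) ∧ Multiset.card p.1 ≤ n ∧ p.2 ⊆ p.1.toFinset := by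
  simp only [AA, Finset.mem_filter, Finset.mem_product, Multiset.mem_toFinset,
    Multiset.mem_powerset, Finset.mem_powerset, and_iff_right_iff_imp]
  rintro ⟨h1, h2, h3⟩
  constructor
  · rw [Multiset.le_iff_count]
    intro i
    by_cases hi : i ∈ p.1
    · have : Multiset.count i (Icc 1 m).val = 1 :=
        Multiset.count_eq_one_of_mem (Icc 1 m).nodup (by simpa using h1 i hi)
      rw [Multiset.count_nsmul, this]
      have := Multiset.count_le_card i p.1
      omega
    · simp [Multiset.count_eq_zero_of_notMem hi]
  · intro i hi
    have := h1 i (by simpa using h3 hi)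
    simpa using this

/-- The weight of an overpartition. -/
noncomputable def ww (p : Multiset ℕ × Finset ℕ) : Polynomial (Polynomial ℤ) :=
  Polynomial.C (Polynomial.X ^ p.2.card) * Polynomial.X ^ p.1.sum

/-- Generating function of overpartitions in an `m × n` box. -/
noncomputable def HH (m n : ℕ) : Polynomial (Polynomial ℤ) := ∑ p ∈ AA m n, ww p

lemma overp_eq (m n k N : ℕ) :
    overp m n k N = ((AA m n).filter fun p => p.1.sum = N ∧ p.2.card = k).card := by
  rw [overp, ← Nat.card_eq_finsetCard]
  refine Nat.card_congr
    { toFun := fun p => ⟨(p.1.1.parts, p.1.2), ?_⟩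
      invFun := fun p => ⟨(⟨p.1.1, ?_, ?_⟩, p.1.2), ?_⟩
      left_inv := fun p => rfl
      right_inv := fun p => rfl }
  · obtain ⟨⟨p, S⟩, h1, h2, h3, h4⟩ := p
    simp only [Finset.mem_filter, mem_AA]
    exact ⟨⟨fun i hi => ⟨p.parts_pos hi, h1 i hi⟩, h2, h3⟩, p.parts_sum, h4⟩
  · intro i hi
    have := p.2
    simp only [Finset.mem_filter, mem_AA] at this
    exact (this.1.1 i hi).1
  · have := p.2
    simp only [Finset.mem_filter, mem_AA] at this
    exact this.2.1
  · have := p.2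
    simp only [Finset.mem_filter, mem_AA] at this
    exact ⟨fun i hi => (this.1.1 i hi).2, this.1.2.1, this.1.2.2, this.2.2⟩

lemma OqtP_eq (m n : ℕ) : OqtP (m + n) n = HH m n := by
  rw [HH, OqtP, Nat.add_sub_cancel, ← Finset.sum_product']
  rw [← Finset.sum_fiberwise_of_maps_to
    (g := fun p : Multiset ℕ × Finset ℕ => (p.1.sum, p.2.card))
    (t := range (m * n + 1) ×ˢ range (n + 1))]
  · refine Finset.sum_congr rfl ?_
    rintro ⟨N, K⟩ -
    have : ∀ p ∈ (AA m n).filter (fun p => (p.1.sum, p.2.card) = (N, K)),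
        ww p = Polynomial.C (Polynomial.X ^ K) * Polynomial.X ^ N := by
      intro p hp
      simp only [Finset.mem_filter, Prod.mk.injEq] at hp
      rw [ww, hp.2.1, hp.2.2]
    rw [Finset.sum_congr rfl this, Finset.sum_const, overp_eq]
    simp only [Prod.mk.injEq, nsmul_eq_mul, map_mul, mul_assoc]
    simp
  · rintro ⟨s, S⟩ hp
    obtain ⟨h1, h2, h3⟩ := mem_AA.1 hp
    simp only at h1 h2 h3
    simp only [Finset.mem_product, Finset.mem_range]
    constructor
    · have := Multiset.sum_le_card_nsmul s m (fun i hi => (h1 i hi).2)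
      rw [smul_eq_mul] at this
      have h4 : Multiset.card s * m ≤ n * m := Nat.mul_le_mul_right _ h2
      rw [mul_comm n m] at h4
      omega
    · have h4 := Finset.card_le_card h3
      have h5 := Multiset.toFinset_card_le s
      omega

lemma ww_nn (p : Multiset ℕ × Finset ℕ) : NNP (ww p) := by
  intro N K
  simp only [ww, Polynomial.coeff_C_mul, Polynomial.coeff_X_pow]
  split_ifs
  · simp only [mul_one, Polynomial.coeff_X_pow]
    split_ifs <;> simp
  · simp

lemma HH_nn (m n : ℕ) : NNP (HH m n) := NNP.sum fun p _ => ww_nn p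

lemma HH_zero_right (m : ℕ) : HH m 0 = 1 := by
  have : AA m 0 = {(0, ∅)} := by
    ext ⟨s, S⟩
    simp only [mem_AA, Finset.mem_singleton, Prod.mk.injEq]
    constructor
    · rintro ⟨h1, h2, h3⟩
      have : s = 0 := by simpa using h2
      subst this
      simpa using h3
    · rintro ⟨rfl, rfl⟩
      simp
  simp [HH, this, ww]

lemma HH_zero_left (n : ℕ) : HH 0 n = 1 := by
  have : AA 0 n = {(0, ∅)} := by
    ext ⟨s, S⟩
    simp only [mem_AA, Finset.mem_singleton, Prod.mk.injEq]
    constructor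
    · rintro ⟨h1, h2, h3⟩
      have : s = 0 := by
        apply Multiset.eq_zero_of_forall_notMem
        intro i hi
        have := h1 i hi
        omega
      subst this
      simpa using h3
    · rintro ⟨rfl, rfl⟩
      simp
  simp [HH, this, ww]

/-- Add a non-overlined part `a`. -/
def phi (a : ℕ) (p : Multiset ℕ × Finset ℕ) : Multiset ℕ × Finset ℕ := (a ::ₘ p.1, p.2)

/-- Add an overlined part `a`. -/
def psi (a : ℕ) (p : Multiset ℕ × Finset ℕ) : Multiset ℕ × Finset ℕ := (a ::ₘ p.1, insert a p.2)

lemma AA_notMem {m n : ℕ} {p : Multiset ℕ × Finset ℕ} (hp : p ∈ AA m n) :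
    m + 1 ∉ p.1 ∧ m + 1 ∉ p.2 := by
  obtain ⟨h1, h2, h3⟩ := mem_AA.1 hp
  have : m + 1 ∉ p.1 := fun h => by have := h1 _ h; omega
  exact ⟨this, fun h => this (by simpa using h3 h)⟩

lemma AA_rec (m n : ℕ) : AA (m + 1) (n + 1) =
    (AA m (n + 1) ∪ (AA (m + 1) n).image (phi (m + 1))) ∪ (AA m n).image (psi (m + 1)) := by
  ext ⟨s, S⟩
  simp only [Finset.mem_union, Finset.mem_image]
  constructor
  · intro hp
    obtain ⟨h1, h2, h3⟩ := mem_AA.1 hp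
    simp only at h1 h2 h3
    by_cases hs : m + 1 ∈ s
    · obtain ⟨r, rfl⟩ := Multiset.exists_cons_of_mem hs
      simp only [Multiset.card_cons] at h2
      by_cases hS : S ⊆ r.toFinset
      · left; right
        refine ⟨(r, S), mem_AA.2 ⟨fun i hi => h1 i (Multiset.mem_cons_of_mem hi), ?_, hS⟩, rfl⟩
        simp only; omega
      · right
        rw [Multiset.toFinset_cons] at h3
        have hmS : m + 1 ∈ S := by
          by_contra h
          exact hS ((Finset.subset_insert_iff_of_notMem h).1 h3)
        have hmr : m + 1 ∉ r := by
          intro h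
          apply hS
          rwa [Finset.insert_eq_of_mem (by simpa using h)] at h3
        refine ⟨(r, S.erase (m + 1)), mem_AA.2 ⟨fun i hi => ?_, ?_, ?_⟩, ?_⟩
        · have := h1 i (Multiset.mem_cons_of_mem hi)
          have : i ≠ m + 1 := fun h => hmr (h ▸ hi)
          omega
        · simp only; omega
        · exact Finset.subset_insert_iff.1 h3
        · simp [psi, Finset.insert_erase hmS]
    · left; left
      refine mem_AA.2 ⟨fun i hi => ?_, h2, h3⟩
      have := h1 i hi
      have : i ≠ m + 1 := fun h => hs (h ▸ hi)
      omega
  · rintro ((hp | ⟨⟨r, T⟩, hp, he⟩) | ⟨⟨r, T⟩, hp, he⟩)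
    · obtain ⟨h1, h2, h3⟩ := mem_AA.1 hp
      refine mem_AA.2 ⟨fun i hi => ?_, h2, h3⟩
      have := h1 i hi
      omega
    · obtain ⟨h1, h2, h3⟩ := mem_AA.1 hp
      rw [← he]
      simp only at h1 h2 h3
      refine mem_AA.2 ⟨fun i hi => ?_, ?_, ?_⟩
      · rcases Multiset.mem_cons.1 hi with rfl | hi
        · omega
        · exact h1 i hi
      · simp only [phi, Multiset.card_cons]; omega
      · simp only [phi, Multiset.toFinset_cons]
        exact h3.trans (Finset.subset_insert _ _)
    · obtain ⟨h1, h2, h3⟩ := mem_AA.1 hp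
      rw [← he]
      simp only at h1 h2 h3
      refine mem_AA.2 ⟨fun i hi => ?_, ?_, ?_⟩
      · rcases Multiset.mem_cons.1 hi with rfl | hi
        · omega
        · have := h1 i hi
          omega
      · simp only [psi, Multiset.card_cons]; omega
      · simp only [psi, Multiset.toFinset_cons]
        exact Finset.insert_subset_insert _ h3

lemma HH_rec (m n : ℕ) : HH (m + 1) (n + 1) = HH m (n + 1)
    + Polynomial.X ^ (m + 1) * HH (m + 1) n
    + (Polynomial.C Polynomial.X * Polynomial.X ^ (m + 1)) * HH m n := by
  rw [HH, AA_rec, Finset.sum_union, Finset.sum_union, Finset.sum_image, Finset.sum_image]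
  · simp only [HH, Finset.mul_sum]
    refine congrArg₂ (· + ·) (congrArg₂ (· + ·) rfl ?_) ?_
    · refine Finset.sum_congr rfl fun p hp => ?_
      simp only [ww, phi, Multiset.sum_cons, pow_add]
      ring
    · refine Finset.sum_congr rfl fun p hp => ?_
      simp only [ww, psi, Multiset.sum_cons, Finset.card_insert_of_notMem (AA_notMem hp).2]
      simp only [pow_add, map_mul, pow_one]
      ring
  · rintro ⟨r, T⟩ hp ⟨r', T'⟩ hp' h
    simp only [psi, Prod.mk.injEq, Multiset.cons_inj_right] at h
    have a1 := (AA_notMem hp).2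
    have a2 := (AA_notMem hp').2
    refine Prod.ext h.1 ?_
    have := congrArg (fun U => U.erase (m + 1)) h.2
    simpa [Finset.erase_insert a1, Finset.erase_insert a2] using this
  · rintro ⟨r, T⟩ hp ⟨r', T'⟩ hp' h
    simp only [phi, Prod.mk.injEq, Multiset.cons_inj_right] at h
    exact Prod.ext h.1 h.2
  · rw [Finset.disjoint_left]
    intro p hp hp'
    obtain ⟨r, hr, rfl⟩ := Finset.mem_image.1 hp'
    exact (AA_notMem hp).1 (by simp [phi])
  · rw [Finset.disjoint_left]
    intro p hp hp'
    obtain ⟨r, hr, rfl⟩ := Finset.mem_image.1 hp'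
    rcases Finset.mem_union.1 hp with hp | hp
    · exact (AA_notMem hp).1 (by simp [psi])
    · obtain ⟨u, hu, he⟩ := Finset.mem_image.1 hp
      simp only [phi, psi, Prod.mk.injEq, Multiset.cons_inj_right] at he
      have := (mem_AA.1 hu).2.2
      rw [he.1, he.2] at this
      exact (AA_notMem hr).1 (by simpa using this (Finset.mem_insert_self _ _))

/-- Shifted generating functions, with value `0` at index `0`. -/
noncomputable def GG (m : ℕ) : ℕ → Polynomial (Polynomial ℤ)
  | 0 => 0
  | n + 1 => HH m n

lemma GG_nonneg (a k b l : ℕ) (hba : b ≤ a) (hkl : k ≤ l) : NNP (DD GG a k b l) := by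
  refine DD_nonneg GG (fun m => Polynomial.X ^ (m + 1))
    (fun m => Polynomial.C Polynomial.X * Polynomial.X ^ (m + 1)) ?_ ?_ ?_ (fun _ => rfl)
    HH_zero_left ?_ _ a k b l rfl hba hkl
  · intro a
    simpa [ww] using ww_nn ({a + 1}, ∅)
  · intro a
    simpa [ww] using ww_nn ({a + 1}, {0})
  · intro a k
    cases k
    · exact NNP.zero
    · exact HH_nn _ _
  · intro a k
    cases k
    · simp [GG, HH_zero_right]
    · exact HH_rec _ _

theorem stmt16 (n k l : ℕ) (hk : 0 < k) (hkl : k ≤ l) (hln : l < n) :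
    ∀ N K : ℕ,
      0 ≤ ((OqtP n k * OqtP n l - OqtP (n - 1) (k - 1) * OqtP (n + 1) (l + 1)).coeff N).coeff K := by
  intro N K
  obtain ⟨k, rfl⟩ : ∃ k', k = k' + 1 := ⟨k - 1, by omega⟩
  obtain ⟨b, rfl⟩ : ∃ b, n = b + l := ⟨n - l, by omega⟩
  obtain ⟨a, ha⟩ : ∃ a, b + l = a + (k + 1) := ⟨b + l - (k + 1), by omega⟩
  have e1 : OqtP (b + l) (k + 1) = HH a (k + 1) := by rw [ha, OqtP_eq]
  have e2 : OqtP (b + l - 1) (k + 1 - 1) = HH a k := by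
    rw [← OqtP_eq, show b + l - 1 = a + k by omega, Nat.add_sub_cancel]
  have e3 : OqtP (b + l + 1) (l + 1) = HH b (l + 1) := by rw [← OqtP_eq, add_assoc]
  rw [e1, e2, e3, OqtP_eq]
  exact GG_nonneg a (k + 1) b l (by omega) hkl N K
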